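/- Let $n\ge 2$, $p\ge 1$ and $v^1,\dots,v^p\in\mathbb{R}^n$. Let $G=\mathbb{R}^3$ with componentwise addition and the lexicographic order, and let $\pi_1:G\to\mathbb{R}$ be the first projection, applied componentwise to vectors in $G^n$. For $K\in\{\mathbb{R},G\}$, $a\in K^n$ and $i\in\{1,\dots,n\}$ put $S(a,i)=\{x\in K^n : x_i-a_i\ge x_j-a_j \text{ for all } j\}$. The tropical polytope generated by $w^1,\dots,w^p\in K^n$ is the set of all $x\in K^n$ of the form $x_k=\max_{1\le r\le p}(\lambda_r+w^r_k)$ for all $k\in\{1,\dots,n\}$, with $\lambda\in K^p$. Given a nonempty proper subset $I\subset\{1,\dots,n\}$ and $j\in\{1,\dots,n\}\setminus I$, a point $a\in K^n$ is an $(I,j)$-pseudovertex of this polytope if, with $S_i(a)=\{r : w^r\in S(a,i)\}$, (i) $\bigcup_{i\in I}S_i(a)=\{1,\dots,p\}$; (ii) for each $k\notin I$ there is $i\in I$ with $S_i(a)\cap S_k(a)\ne\emptyset$; (iii) for each $i\in I$, $S_i(a)\cap S_j(a)\not\subseteq\bigcup_{h\in I\setminus\{i\}}S_h(a)$. For $a\in\mathbb{R}^n$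 and $\emptyset\ne I\subsetneq\{1,\dots,n\}$ let $H(a,I)=\{x\in\mathbb{R}^n : \max_{i\in I}(x_i-a_i)\ge\max_{j\notin I}(x_j-a_j)\}$. Let $P\subseteq\mathbb{R}^n$ be the tropical polytope generated by $v^1,\dots,v^p$, and assume that $P$ is pure, i.e. that $\{x\in P : x_1=0\}$ equals the closure of its interior relative to the hyperplane $\{x\in\mathbb{R}^n : x_1=0\}$. Call $v\in P$ an extreme point of $P$ of type $k$ if every $x\in P\cap S(v,k)$ is of the form $v+c(1,\dots,1)$ with $c\in\mathbb{R}$. Let $\gamma^1,\dots,\gamma^p\in\mathbb{R}^n$, and let $\tilde P\subseteq G^n$ be the tropical polytope generated by the points $\tilde v^1,\dots,\tilde v^p\in G^n$ with $\tilde v^r_k=(v^r_k,1,\gamma^r_k)$ if $v^r$ is an extreme point of $P$ of type $k$, and $\tilde v^r_k=(v^r_k,0,\gamma^r_k)$ otherwise. Consider the set of all half-spaces $H(\pi_1(\tilde a),I)\subseteq\mathbb{R}^n$ such that $\emptyset\ne I\subsetneq\{1,\dots,n\}$ and $\tilde a\in G^n$ is an $(I,j)$-pseudovertex of $\tilde P$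 (with respect to the generators $\tilde v^1,\dots,\tilde v^p$) for some $j\in\{1,\dots,n\}\setminus I$. This set of half-spaces is finite, and its intersection equals $P$. -/

import Mathlib

section TropicalDefs

variable {α : Type*} [LinearOrder α] [AddCommGroup α]

/-- The sector `S(a,i) = {x | x_i - a_i ≥ x_j - a_j for all j}`. -/
def sector {n : ℕ} (a : Fin n → α) (i : Fin n) : Set (Fin n → α) :=
  {x | ∀ j, x j - a j ≤ x i - a i}

/-- The tropical polytope generated by the points `v 0, …, v (p-1)`:
each coordinate of `x` is the maximum over `r` of `l r + v r i`. -/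
def tropPoly {n p : ℕ} (v : Fin p → Fin n → α) : Set (Fin n → α) :=
  {x | ∃ l : Fin p → α, ∀ i, IsGreatest (Set.range fun r => l r + v r i) (x i)}

/-- `v` is an extreme point of `P` of type `i`: up to adding a constant vector, it is the only
point of `P` in the sector `S(v,i)`. -/
def ExtremeOfType {n : ℕ} (P : Set (Fin n → α)) (v : Fin n → α) (i : Fin n) : Prop :=
  v ∈ P ∧ ∀ x ∈ P ∩ sector v i, ∃ c : α, x = fun k => v k + c

/-- The tropical half-space `H(a,I)`: `max_{i ∈ I} (x_i - a_i) ≥ max_{j ∉ I} (x_j - a_j)`. -/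
def halfSpace {n : ℕ} (a : Fin n → α) (I : Set (Fin n)) : Set (Fin n → α) :=
  {x | ∃ i ∈ I, ∀ j ∉ I, x j - a j ≤ x i - a i}

/-- `S_i(a)`, the set of indices `r` such that `v r ∈ S(a,i)`. -/
def typeSet {n p : ℕ} (v : Fin p → Fin n → α) (a : Fin n → α) (i : Fin n) : Set (Fin p) :=
  {r | v r ∈ sector a i}

/-- `a` is an `(I,j)`-pseudovertex of the tropical polytope generated by `v`. -/
def IsPseudovertex {n p : ℕ} (v : Fin p → Fin n → α) (a : Fin n → α) (I : Set (Fin n))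
    (j : Fin n) : Prop :=
  (⋃ i ∈ I, typeSet v a i) = Set.univ ∧
  (∀ k ∉ I, ∃ i ∈ I, (typeSet v a i ∩ typeSet v a k).Nonempty) ∧
  (∀ i ∈ I, ¬ typeSet v a i ∩ typeSet v a j ⊆ ⋃ h ∈ I \ {i}, typeSet v a h)

end TropicalDefs

/-- `P` is pure: `P₀ = {x ∈ P | x 0 = 0}` equals the closure of its interior, relative to
the hyperplane `{x | x 0 = 0}` with the subspace topology. -/
def IsPure {n : ℕ} [NeZero n] (P : Set (Fin n → ℝ)) : Prop :=
  letI P0 : Set {x : Fin n → ℝ // x 0 = 0} := {x | (x : Fin n → ℝ) ∈ P}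
  P0 = closure (interior P0)

/-- The group `G = ℝ³` with componentwise addition and the lexicographic order. -/
abbrev LexR3 : Type := ℝ ×ₗ ℝ ×ₗ ℝ

/-- First coordinate projection `π₁ : G → ℝ`. -/
def LexR3.pi1 (g : LexR3) : ℝ := (ofLex g).1

/-- The element `(a, b, c)` of `G`. -/
def LexR3.mk (a b c : ℝ) : LexR3 := toLex (a, toLex (b, c))

open Classical in
/-- The perturbed generators: `ṽ^r_k = (v^r_k, 1, γ^r_k)` if `v^r` is an extreme point of type `k`
of the polytope generated by `v`, and `ṽ^r_k = (v^r_k, 0, γ^r_k)` otherwise. -/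
noncomputable def perturbed {n p : ℕ} (v γ : Fin p → Fin n → ℝ) : Fin p → Fin n → LexR3 :=
  fun r k => LexR3.mk (v r k) (if ExtremeOfType (tropPoly v) (v r) k then 1 else 0) (γ r k)

/-- The half-spaces `H(π₁(ã), I)` of `ℝ^n`, where `ã` is an `(I,j)`-pseudovertex of the perturbed
polytope for some nonempty proper `I` and some `j ∉ I`. -/
def projectedHalfSpaces {n p : ℕ} (v γ : Fin p → Fin n → ℝ) : Set (Set (Fin n → ℝ)) :=
  {H | ∃ (a : Fin n → LexR3) (I : Set (Fin n)) (j : Fin n),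
    I.Nonempty ∧ I ≠ Set.univ ∧ j ∉ I ∧ IsPseudovertex (perturbed v γ) a I j ∧
    H = halfSpace (fun k => (a k).pi1) I}

section TropicalHalfSpaces

variable {α : Type*} [LinearOrder α] [AddCommGroup α]

/-- If the generators lie in a tropical half-space, so does the tropical polytope. -/
theorem tropPoly_subset_halfSpace [IsOrderedAddMonoid α] {n p : ℕ} (hp : 1 ≤ p)
    (v : Fin p → Fin n → α) (a : Fin n → α) (I : Set (Fin n))
    (h : ∀ r, v r ∈ halfSpace a I) : tropPoly v ⊆ halfSpace a I := by
  rintro x ⟨l, hl⟩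
  have : Nonempty (Fin p) := ⟨⟨0, hp⟩⟩
  choose i hiI hi using h
  obtain ⟨r, -, hr⟩ := Finset.exists_max_image Finset.univ
    (fun r => l r + v r (i r) - a (i r)) Finset.univ_nonempty
  refine ⟨i r, hiI r, fun j hj => ?_⟩
  obtain ⟨s, hs⟩ := (hl j).1
  have h1 : l r + v r (i r) ≤ x (i r) := (hl (i r)).2 ⟨r, rfl⟩
  calc x j - a j = l s + (v s j - a j) := by rw [← hs]; simp only; abel
    _ ≤ l s + (v s (i s) - a (i s)) := add_le_add_right (hi s j hj) _
    _ = l s + v s (i s) - a (i s) := by abel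
    _ ≤ l r + v r (i r) - a (i r) := hr s (Finset.mem_univ s)
    _ ≤ x (i r) - a (i r) := by gcongr

/-- Tightening an inequality `x_j - c_j ≤ max_{i ≠ j} (x_i - c_i)` valid for all generators:
each `c_i` is raised, or `i` is discarded, until some generator prevents raising it further. -/
theorem exists_tight_inequality [IsOrderedAddMonoid α] {n p : ℕ} (v : Fin p → Fin n → α)
    (c : Fin n → α) (j : Fin n) (hc : ∀ r, ∃ i, i ≠ j ∧ v r j - c j ≤ v r i - c i) :
    ∃ (a : Fin n → α) (I : Finset (Fin n)), j ∉ I ∧ a j = c j ∧ (∀ i ∈ I, c i ≤ a i) ∧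
      (∀ r, ∃ i ∈ I, v r j - a j ≤ v r i - a i) ∧
      ∀ i ∈ I, ∃ r, v r i - a i = v r j - a j ∧
        ∀ h ∈ I, h ≠ i → v r h - a h < v r j - a j := by
  suffices H : ∀ T : Finset (Fin n), ∃ (a : Fin n → α) (I : Finset (Fin n)),
      j ∉ I ∧ a j = c j ∧ (∀ i ∈ I, c i ≤ a i) ∧
      (∀ r, ∃ i ∈ I, v r j - a j ≤ v r i - a i) ∧
      ∀ i ∈ I, i ∈ T → ∃ r, v r i - a i = v r j - a j ∧
        ∀ h ∈ I, h ≠ i → v r h - a h < v r j - a j by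
    obtain ⟨a, I, h1, h2, h3, h4, h5⟩ := H Finset.univ
    exact ⟨a, I, h1, h2, h3, h4, fun i hi => h5 i hi (Finset.mem_univ i)⟩
  intro T
  induction T using Finset.induction_on with
  | empty =>
    refine ⟨c, Finset.univ.erase j, by simp, rfl, fun _ _ => le_rfl, fun r => ?_, by simp⟩
    obtain ⟨i, hij, hi⟩ := hc r
    exact ⟨i, by simp [hij], hi⟩
  | insert t T ht ih =>
    obtain ⟨a, I, hjI, haj, hca, hval, htight⟩ := ih
    by_cases htI : t ∈ I
    swap
    · refine ⟨a, I, hjI, haj, hca, hval, fun i hi hiT => htight i hi ?_⟩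
      exact (Finset.mem_insert.1 hiT).resolve_left (fun h => htI (h ▸ hi))
    have hjt : j ≠ t := fun h => hjI (h ▸ htI)
    let R : Finset (Fin p) :=
      Finset.univ.filter fun r => ∀ h ∈ I, h ≠ t → v r h - a h < v r j - a j
    rcases R.eq_empty_or_nonempty with hR | hR
    · refine ⟨a, I.erase t, fun h => hjI (Finset.mem_of_mem_erase h), haj,
        fun i hi => hca i (Finset.mem_of_mem_erase hi), fun r => ?_, fun i hi hiT => ?_⟩
      · have hr : r ∉ R := by simp [hR]
        simp only [R, Finset.mem_filter, Finset.mem_univ, true_and, not_forall, not_lt] at hr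
        obtain ⟨h, hI, hne, hle⟩ := hr
        exact ⟨h, Finset.mem_erase.2 ⟨hne, hI⟩, hle⟩
      · obtain ⟨hne, hiI⟩ := Finset.mem_erase.1 hi
        obtain ⟨r, hr, hlt⟩ := htight i hiI ((Finset.mem_insert.1 hiT).resolve_left hne)
        exact ⟨r, hr, fun h hh => hlt h (Finset.mem_of_mem_erase hh)⟩
    · obtain ⟨s, hsR, hs⟩ := Finset.exists_min_image R (fun r => v r t - v r j + a j) hR
      have hR' : ∀ r, r ∈ R ↔ ∀ h ∈ I, h ≠ t → v r h - a h < v r j - a j := by simp [R]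
      have hle : a t ≤ v s t - v s j + a j := by
        obtain ⟨i, hi, hsi⟩ := hval s
        have hit : i = t := by
          by_contra hit
          exact absurd hsi (not_le.2 ((hR' s).1 hsR i hi hit))
        subst hit
        calc a i = (v s j - a j) + (a i - v s j + a j) := by abel
          _ ≤ (v s i - a i) + (a i - v s j + a j) := by gcongr
          _ = _ := by abel
      have hval' : ∀ r ∈ R, v r j - a j ≤ v r t - (v s t - v s j + a j) := fun r hr => by
        have := hs r hr
        calc v r j - a j = v r t - (v r t - v r j + a j) := by abel
          _ ≤ _ := by gcongr
      refine ⟨Function.update a t (v s t - v s j + a j), I, hjI, ?_, ?_, ?_, ?_⟩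
      · rw [Function.update_of_ne hjt, haj]
      · intro i hi
        by_cases hit : i = t
        · subst hit
          rw [Function.update_self]
          exact (hca i hi).trans hle
        · rw [Function.update_of_ne hit]
          exact hca i hi
      · intro r
        rw [Function.update_of_ne hjt]
        by_cases hr : r ∈ R
        · exact ⟨t, htI, by rw [Function.update_self]; exact hval' r hr⟩
        · rw [hR'] at hr
          push Not at hr
          obtain ⟨h, hI, hne, hh⟩ := hr
          exact ⟨h, hI, by rw [Function.update_of_ne hne]; exact hh⟩
      · intro i hi hiT
        rw [Function.update_of_ne hjt]
        by_cases hit : i = t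
        · subst hit
          refine ⟨s, by rw [Function.update_self]; abel, fun h hh hne => ?_⟩
          rw [Function.update_of_ne hne]
          exact (hR' s).1 hsR h hh hne
        · obtain ⟨r, hr, hlt⟩ := htight i hi ((Finset.mem_insert.1 hiT).resolve_left hit)
          refine ⟨r, by rw [Function.update_of_ne hit]; exact hr, fun h hh hne => ?_⟩
          by_cases hht : h = t
          · subst hht
            rw [Function.update_self]
            refine lt_of_le_of_lt ?_ (hlt h hh hne)
            gcongr
          · rw [Function.update_of_ne hht]
            exact hlt h hh hne

/-- A tight inequality `x_j - a_j ≤ max_{i ∈ I} (x_i - a_i)` extends to an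
`(I,j)`-pseudovertex. -/
theorem exists_isPseudovertex_of_tight [IsOrderedAddMonoid α] {n p : ℕ} (hp : 1 ≤ p)
    (v : Fin p → Fin n → α) (a : Fin n → α) (I : Finset (Fin n)) (j : Fin n)
    (hval : ∀ r, ∃ i ∈ I, v r j - a j ≤ v r i - a i)
    (htight : ∀ i ∈ I, ∃ r, v r i - a i = v r j - a j ∧
      ∀ h ∈ I, h ≠ i → v r h - a h < v r j - a j) :
    ∃ b : Fin n → α, b j = a j ∧ (∀ i ∈ I, b i = a i) ∧ IsPseudovertex v b I j := by
  have : Nonempty (Fin p) := ⟨⟨0, hp⟩⟩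
  have hI : I.Nonempty := by
    obtain ⟨i, hi, -⟩ := hval ⟨0, hp⟩
    exact ⟨i, hi⟩
  have hmax (r : Fin p) := Finset.exists_max_image I (fun i => v r i - a i) hI
  choose m hmI hm using hmax
  let f : Fin n → Fin p → α := fun k r => v r k - (v r (m r) - a (m r))
  let b : Fin n → α := fun k =>
    if k ∈ I ∨ k = j then a k else Finset.univ.sup' Finset.univ_nonempty (f k)
  have hbj : b j = a j := by simp [b]
  have hbI : ∀ i ∈ I, b i = a i := fun i hi => by simp [b, hi]
  have hbk : ∀ k, k ∉ I → k ≠ j → b k = Finset.univ.sup' Finset.univ_nonempty (f k) :=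
    fun k h1 h2 => by simp [b, h1, h2]
  have hle : ∀ r k, v r k - b k ≤ v r (m r) - a (m r) := fun r k => by
    by_cases hk : k ∈ I
    · rw [hbI k hk]
      exact hm r k hk
    by_cases hkj : k = j
    · rw [hkj, hbj]
      obtain ⟨i, hi, h⟩ := hval r
      exact h.trans (hm r i hi)
    · have : f k r ≤ b k := by
        rw [hbk k hk hkj]
        exact Finset.le_sup' (f k) (Finset.mem_univ r)
      calc v r k - b k ≤ v r k - f k r := by gcongr
        _ = _ := by simp only [f]; abel
  have hmS : ∀ r, r ∈ typeSet v b (m r) := fun r k => by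
    rw [hbI _ (hmI r)]
    exact hle r k
  have hS : ∀ r k, v r k - b k = v r (m r) - a (m r) → r ∈ typeSet v b k :=
    fun r k h k' => by
      rw [h]
      exact hle r k'
  have hwit : ∀ i ∈ I, ∃ r, r ∈ typeSet v b i ∧ r ∈ typeSet v b j ∧
      ∀ h ∈ I, h ≠ i → r ∉ typeSet v b h := fun i hi => by
    obtain ⟨r, hr, hlt⟩ := htight i hi
    have hmi : m r = i := by
      by_contra hne
      have h1 := hlt (m r) (hmI r) hne
      rw [← hr] at h1
      exact absurd (hm r i hi) (not_le.2 h1)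
    refine ⟨r, hmi ▸ hmS r, hS r j (by rw [hbj, hmi, hr]), fun h hh hne hmem => ?_⟩
    have h1 := hmem j
    rw [hbj, hbI h hh] at h1
    exact absurd h1 (not_le.2 (hlt h hh hne))
  refine ⟨b, hbj, hbI, ?_, ?_, ?_⟩
  · rw [Set.eq_univ_iff_forall]
    exact fun r => Set.mem_biUnion (Finset.mem_coe.2 (hmI r)) (hmS r)
  · intro k hk
    by_cases hkj : k = j
    · obtain ⟨i, hi⟩ := hI
      obtain ⟨r, h1, h2, -⟩ := hwit i hi
      exact ⟨i, hi, r, h1, hkj ▸ h2⟩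
    · obtain ⟨r, -, hr⟩ := Finset.exists_mem_eq_sup' Finset.univ_nonempty (f k)
      refine ⟨m r, hmI r, r, hmS r, hS r k ?_⟩
      rw [hbk k hk hkj, hr]
      simp only [f]
      abel
  · intro i hi hsub
    obtain ⟨r, h1, h2, h3⟩ := hwit i hi
    obtain ⟨h, hh, hr⟩ := Set.mem_iUnion₂.1 (hsub ⟨h1, h2⟩)
    exact h3 h hh.1 hh.2 hr

/-- A point outside the tropical polytope violates an inequality valid for all generators. -/
theorem exists_separating_of_notMem_tropPoly [IsOrderedAddMonoid α] {n p : ℕ} [NeZero n]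
    (v : Fin p → Fin n → α) (y : Fin n → α) (hy : y ∉ tropPoly v) :
    ∃ j, ∀ r, ∃ i, i ≠ j ∧ v r j - y j < v r i - y i := by
  have hmax (r : Fin p) := Finset.exists_max_image Finset.univ (fun i => v r i - y i)
    Finset.univ_nonempty
  choose m _ hm using hmax
  by_contra! hcon
  refine hy ⟨fun r => y (m r) - v r (m r), fun i => ⟨?_, ?_⟩⟩
  · obtain ⟨r, hr⟩ := hcon i
    refine ⟨r, ?_⟩
    have h : v r (m r) - y (m r) = v r i - y i := by
      by_cases him : m r = i
      · rw [him]
      · exact le_antisymm (hr _ him) (hm r i (Finset.mem_univ i))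
    calc y (m r) - v r (m r) + v r i = v r i - (v r (m r) - y (m r)) := by abel
      _ = y i := by rw [h]; abel
  · rintro _ ⟨r, rfl⟩
    calc y (m r) - v r (m r) + v r i = (v r i - y i) + (y i + y (m r) - v r (m r)) := by abel
      _ ≤ (v r (m r) - y (m r)) + (y i + y (m r) - v r (m r)) :=
        add_le_add_left (hm r i (Finset.mem_univ i)) _
      _ = y i := by abel

/-- The coordinates of a pseudovertex are determined, up to a common translation, by finitely
many choices among the coordinates of the generators. -/
theorem IsPseudovertex.exists_sub_eq {n p : ℕ} {v : Fin p → Fin n → α} {a : Fin n → α}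
    {I : Set (Fin n)} {j : Fin n} (h : IsPseudovertex v a I j) (k : Fin n) :
    ∃ r s i, a k - a j = (v r k - v r i) + (v s i - v s j) := by
  have key : ∀ i k, ∀ r ∈ typeSet v a i ∩ typeSet v a k, a k - a i = v r k - v r i := by
    rintro i k r ⟨h1, h2⟩
    have h3 : v r k - a k = v r i - a i := le_antisymm (h1 k) (h2 i)
    rw [sub_eq_sub_iff_add_eq_add] at h3 ⊢
    rw [add_comm, ← h3, add_comm]
  have hI : ∀ i ∈ I, ∃ s, a i - a j = v s i - v s j := fun i hi => by
    obtain ⟨s, hs, -⟩ := Set.not_subset.1 (h.2.2 i hi)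
    exact ⟨s, key j i s hs.symm⟩
  by_cases hk : k ∈ I
  · obtain ⟨s, hs⟩ := hI k hk
    exact ⟨s, s, k, by rw [hs, sub_self, zero_add]⟩
  · obtain ⟨i, hi, r, hr⟩ := h.2.1 k hk
    obtain ⟨s, hs⟩ := hI i hi
    exact ⟨r, s, i, by rw [← key i k r hr, ← hs, sub_add_sub_cancel]⟩

end TropicalHalfSpaces

theorem LexR3.pi1_mono {x y : LexR3} (h : x ≤ y) : x.pi1 ≤ y.pi1 :=
  Prod.Lex.monotone_fst x y h

theorem LexR3.pi1_sub (x y : LexR3) : (x - y).pi1 = x.pi1 - y.pi1 := rfl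

theorem LexR3.pi1_add (x y : LexR3) : (x + y).pi1 = x.pi1 + y.pi1 := rfl

theorem LexR3.le_of_pi1_lt {x y : LexR3} (h : x.pi1 < y.pi1) : x ≤ y :=
  le_of_not_ge fun hle => absurd (LexR3.pi1_mono hle) (not_le.2 h)

theorem pi1_perturbed {n p : ℕ} (v γ : Fin p → Fin n → ℝ) (r : Fin p) (k : Fin n) :
    (perturbed v γ r k).pi1 = v r k := rfl

theorem projectedHalfSpaces_finite {n p : ℕ} (v γ : Fin p → Fin n → ℝ) :
    (projectedHalfSpaces v γ).Finite := by
  let g : Fin n → Fin n → Fin p × Fin p × Fin n → ℝ := fun j k q =>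
    (v q.1 k - v q.1 q.2.2) + (v q.2.1 q.2.2 - v q.2.1 j)
  refine (Set.finite_range (fun q : Set (Fin n) × Fin n × (Fin n → Fin p × Fin p × Fin n) =>
    halfSpace (fun k => g q.2.1 k (q.2.2 k)) q.1)).subset ?_
  rintro _ ⟨a, I, j, -, -, -, ha, rfl⟩
  choose r s i h using ha.exists_sub_eq
  refine ⟨(I, j, fun k => (r k, s k, i k)), ?_⟩
  have hg : ∀ k, g j k (r k, s k, i k) = (a k).pi1 - (a j).pi1 := fun k => by
    have := congrArg LexR3.pi1 (h k)
    simp only [LexR3.pi1_sub, LexR3.pi1_add, pi1_perturbed] at this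
    exact this.symm
  ext x
  simp only [halfSpace, hg, Set.mem_ofPred_eq]
  refine exists_congr fun i => and_congr_right fun _ => forall₂_congr fun k _ => ?_
  constructor <;> intro h <;> linarith

theorem tropPoly_subset_of_mem_projectedHalfSpaces {n p : ℕ} (hp : 1 ≤ p)
    (v γ : Fin p → Fin n → ℝ) {H : Set (Fin n → ℝ)} (hH : H ∈ projectedHalfSpaces v γ) :
    tropPoly v ⊆ H := by
  obtain ⟨a, I, j, -, -, -, ha, rfl⟩ := hH
  refine tropPoly_subset_halfSpace hp v _ I fun r => ?_
  obtain ⟨i, hi, hr⟩ := Set.mem_iUnion₂.1 (Set.eq_univ_iff_forall.1 ha.1 r)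
  exact ⟨i, hi, fun k _ => LexR3.pi1_mono (hr k)⟩

theorem exists_mem_projectedHalfSpaces_notMem {n p : ℕ} [NeZero n] (hp : 1 ≤ p)
    (v γ : Fin p → Fin n → ℝ) {y : Fin n → ℝ} (hy : y ∉ tropPoly v) :
    ∃ H ∈ projectedHalfSpaces v γ, y ∉ H := by
  have : Nonempty (Fin p) := ⟨⟨0, hp⟩⟩
  obtain ⟨j, hj⟩ := exists_separating_of_notMem_tropPoly v y hy
  choose m hmj hm using hj
  obtain ⟨s, -, hs⟩ := Finset.exists_max_image Finset.univ
    (fun r => v r j - (v r (m r) - y (m r))) Finset.univ_nonempty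
  obtain ⟨t, hst, hty⟩ : ∃ t, v s j - (v s (m s) - y (m s)) < t ∧ t < y j :=
    exists_between (by linarith [hm s])
  let c : Fin n → LexR3 := fun k => LexR3.mk (if k = j then t else y k) 0 0
  have hcj : (c j).pi1 = t := if_pos rfl
  have hck : ∀ k, k ≠ j → (c k).pi1 = y k := fun k hk => if_neg hk
  obtain ⟨a, I, hjI, haj, hca, hval, htight⟩ :=
    exists_tight_inequality (perturbed v γ) c j fun r => ⟨m r, hmj r, LexR3.le_of_pi1_lt (by
      rw [LexR3.pi1_sub, LexR3.pi1_sub, pi1_perturbed, pi1_perturbed, hcj, hck _ (hmj r)]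
      linarith [hs r (Finset.mem_univ r)])⟩
  obtain ⟨b, hbj, hbI, hb⟩ := exists_isPseudovertex_of_tight hp _ a I j hval htight
  have hjI' : j ∉ (I : Set (Fin n)) := hjI
  refine ⟨_, ⟨b, I, j, ?_, fun h => hjI' (h ▸ Set.mem_univ j), hjI', hb, rfl⟩, ?_⟩
  · obtain ⟨i, hi, -⟩ := hval ⟨0, hp⟩
    exact ⟨i, hi⟩
  · rintro ⟨i, hi, h⟩
    have hij : i ≠ j := fun h => hjI (h ▸ hi)
    have h1 := h j hjI'
    have h2 := LexR3.pi1_mono (hca i hi)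
    rw [hck i hij] at h2
    simp only [hbj, haj, hcj, hbI i hi] at h1
    linarith

/-- If `P` is pure, the half-spaces `H(π₁(ã), I)` associated with the `(I,j)`-pseudovertices `ã` of
the perturbed polytope form an external representation of `P`: there are finitely many of them,
and their intersection is `P`. -/
theorem pure_eq_sInter_perturbed_pseudovertex_halfspaces {n p : ℕ} [NeZero n] (hn : 2 ≤ n)
    (hp : 1 ≤ p) (v γ : Fin p → Fin n → ℝ) (hpure : IsPure (tropPoly v)) :
    (projectedHalfSpaces v γ).Finite ∧ tropPoly v = ⋂₀ projectedHalfSpaces v γ := by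
  refine ⟨projectedHalfSpaces_finite v γ, Set.Subset.antisymm ?_ fun y hy => ?_⟩
  · exact Set.subset_sInter fun H hH => tropPoly_subset_of_mem_projectedHalfSpaces hp v γ hH
  · by_contra hyP
    obtain ⟨H, hH, hyH⟩ := exists_mem_projectedHalfSpaces_notMem hp v γ hyP
    exact hyH (hy H hH)
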